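/- If a two-variable-valued clone C on {0,1} is not a discriminator clone (does not contain the ternary discriminator), then the C-equivalence relation has infinitely many classes in the set of all Boolean functions. -/

import Mathlib

/-- An `n`-indexed operation on `A` has arity `n + 1` (so arities are ≥ 1). -/
abbrev Op (A : Type) (n : ℕ) := (Fin (n + 1) → A) → A

/-- A clone on `A`: a set of finitary operations containing all projections
and closed under composition. -/
structure Clone (A : Type) where
  ops : ∀ n : ℕ, Set (Op A n)
  proj_mem : ∀ (n : ℕ) (i : Fin (n + 1)), (fun x => x i) ∈ ops n
  comp_mem : ∀ {m n : ℕ} (g : Op A m) (h : Fin (m + 1) → Op A n),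
      g ∈ ops m → (∀ i, h i ∈ ops n) → (fun x => g fun i => h i x) ∈ ops n

/-- The set `O_A` of all finitary operations on `A`, of all arities. -/
def Ops (A : Type) := Σ n : ℕ, Op A n

/-- `Minor C f g` : `f` is a `C`-minor of `g`, i.e. `f = g ∘ h` for a tuple `h`
of operations from `C`. -/
def Minor {A : Type} (C : Clone A) (f g : Ops A) : Prop :=
  ∃ h : Fin (g.1 + 1) → Op A f.1,
    (∀ i, h i ∈ C.ops f.1) ∧ f.2 = fun x => g.2 fun i => h i x

/-- `C`-equivalence: each of `f`, `g` is a `C`-minor of the other. -/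
def CEquiv {A : Type} (C : Clone A) (f g : Ops A) : Prop :=
  Minor C f g ∧ Minor C g f

/-- The ternary discriminator as an operation of arity 3 (index 2). -/
def discOp (A : Type) [DecidableEq A] : Op A 2 :=
  fun x => if x 0 = x 1 then x 2 else x 0

namespace PostAux

abbrev B := Fin 2
abbrev T3 := B → B → B → B

theorem two (x : B) : x = 0 ∨ x = 1 := by revert x; decide

theorem add11 (x : B) : x + 1 + 1 = x := by revert x; decide

/-- abstract ternary part of a clone -/
structure Cl (S : Set T3) : Prop where
  p1 : (fun x _ _ => x) ∈ S
  p2 : (fun _ y _ => y) ∈ S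
  p3 : (fun _ _ z => z) ∈ S
  comp : ∀ f a b c : T3, f ∈ S → a ∈ S → b ∈ S → c ∈ S →
    (fun x y z => f (a x y z) (b x y z) (c x y z)) ∈ S

def tt : T3 := fun x y z => if x = y then z else x
def maj : T3 := fun x y z => x * y + y * z + z * x
def mino : T3 := fun x y z => x + y + z
def neg1 : T3 := fun x _ _ => x + 1
def and2 : T3 := fun x y _ => x * y
def or2 : T3 := fun x y _ => x + y + x * y
def imp2 : T3 := fun x y _ => 1 + x + x * y
def k (c : B) : T3 := fun _ _ _ => c

theorem ext3 {f g : T3} (h : f 0 0 0 = g 0 0 0 ∧ f 0 0 1 = g 0 0 1 ∧ f 0 1 0 = g 0 1 0 ∧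
    f 0 1 1 = g 0 1 1 ∧ f 1 0 0 = g 1 0 0 ∧ f 1 0 1 = g 1 0 1 ∧ f 1 1 0 = g 1 1 0 ∧
    f 1 1 1 = g 1 1 1) : f = g := by
  obtain ⟨h0, h1, h2, h3, h4, h5, h6, h7⟩ := h
  funext x y z
  rcases two x with rfl | rfl <;> rcases two y with rfl | rfl <;> rcases two z with rfl | rfl <;>
    assumption

theorem mem3 {S : Set T3} {f g : T3} (hf : f ∈ S)
    (h : f 0 0 0 = g 0 0 0 ∧ f 0 0 1 = g 0 0 1 ∧ f 0 1 0 = g 0 1 0 ∧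
    f 0 1 1 = g 0 1 1 ∧ f 1 0 0 = g 1 0 0 ∧ f 1 0 1 = g 1 0 1 ∧ f 1 1 0 = g 1 1 0 ∧
    f 1 1 1 = g 1 1 1) : g ∈ S := ext3 h ▸ hf

variable {S : Set T3}

theorem tt_of_maj_neg (hS : Cl S) (hm : maj ∈ S) (hn : neg1 ∈ S) : tt ∈ S :=
  mem3 (hS.comp _ _ _ _ hm hS.p1 (hS.comp _ _ _ _ hn hS.p2 hS.p2 hS.p2) hS.p3) (by decide)

theorem maj_of (hS : Cl S) (ha : and2 ∈ S) (ho : or2 ∈ S) : maj ∈ S := by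
  have h1 := hS.comp _ _ _ _ ha hS.p1 hS.p2 hS.p2
  have h2 := hS.comp _ _ _ _ ha hS.p2 hS.p3 hS.p3
  have h3 := hS.comp _ _ _ _ ha hS.p1 hS.p3 hS.p3
  have h4 := hS.comp _ _ _ _ ho h1 h2 h2
  have h5 := hS.comp _ _ _ _ ho h4 h3 h3
  exact mem3 h5 (by decide)

theorem tt_of_and_or (hS : Cl S) (ha : and2 ∈ S) (ho : or2 ∈ S) {m : T3} (hm : m ∈ S)
    (m1 : m 0 0 1 = 1) (m2 : m 0 1 1 = 0) : tt ∈ S := by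
  have h1 := hS.comp _ _ _ _ ha hS.p1 hS.p2 hS.p2
  have h2 := hS.comp _ _ _ _ ha h1 hS.p3 hS.p3
  have h3 := hS.comp _ _ _ _ ho hS.p1 hS.p2 hS.p2
  have h4 := hS.comp _ _ _ _ ho h3 hS.p3 hS.p3
  have h5 := hS.comp _ _ _ _ hm h2 hS.p2 h4
  have h6 := hS.comp _ _ _ _ (maj_of hS ha ho) hS.p1 h5 hS.p3
  refine mem3 h6 ?_
  simp [maj, tt, and2, or2, m1, m2]
  rcases two (m 0 0 0) with h | h <;> rcases two (m 1 1 1) with h' | h' <;> simp [h, h']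

theorem sd_lemma (hS : Cl S) (sd : ∀ f ∈ S, ∀ x y z, f (x+1) (y+1) (z+1) = f x y z + 1)
    {q : T3} (hq : q ∈ S) (q0 : q 0 0 0 = 0)
    (qq : q 0 0 0 + q 0 0 1 + q 0 1 0 + q 0 1 1 = 1) : maj ∈ S ∨ tt ∈ S := by
  have s0 := sd q hq 0 0 0
  have s1 := sd q hq 0 0 1
  have s2 := sd q hq 0 1 0
  have s3 := sd q hq 0 1 1
  simp at s0 s1 s2 s3
  rw [q0] at qq s0
  have e : (1 + 1 : B) = 0 := by decide
  rcases two (q 0 0 1) with h1 | h1 <;> rcases two (q 0 1 0) with h2 | h2 <;>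
    rcases two (q 0 1 1) with h3 | h3 <;> rw [h1, h2, h3] at qq <;>
    rw [h1] at s1 <;> rw [h2] at s2 <;> rw [h3] at s3 <;> try (exact absurd qq (by decide))
  · left
    exact mem3 hq (by simp [maj, *])
  · right
    refine mem3 (hS.comp _ _ _ _ hq hS.p3 hS.p1 hS.p2) (by simp [tt, *])
  · right
    refine mem3 (hS.comp _ _ _ _ hq hS.p1 hS.p2 hS.p3) (by simp [tt, *])
  · right
    refine mem3 (hS.comp _ _ _ _ hq hS.p2 hS.p1 hS.p3) (by simp [tt, *])

theorem case_neg (hS : Cl S) (hn : neg1 ∈ S) {m q : T3} (hm : m ∈ S)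
    (m1 : m 0 0 1 = 1) (m2 : m 0 1 1 = 0) (hq : q ∈ S)
    (qq : q 0 0 0 + q 0 0 1 + q 0 1 0 + q 0 1 1 = 1) : tt ∈ S := by
  have ng : ∀ f ∈ S, ∀ c : B, (fun x y z => f x y z + c) ∈ S := by
    intro f hf c
    rcases two c with rfl | rfl
    · simpa using hf
    · exact hS.comp _ _ _ _ hn hf hf hf
  by_cases sd : ∀ f ∈ S, ∀ x y z, f (x+1) (y+1) (z+1) = f x y z + 1
  · have : maj ∈ S ∨ tt ∈ S := by
      rcases two (q 0 0 0) with h | h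
      · exact sd_lemma hS sd hq h qq
      · refine sd_lemma hS sd (ng q hq 1) (by simp [h]) ?_
        generalize q 0 0 0 = a at *
        generalize q 0 0 1 = b at *
        generalize q 0 1 0 = c at *
        generalize q 0 1 1 = d at *
        revert a b c d; decide
    rcases this with h | h
    · exact tt_of_maj_neg hS h hn
    · exact h
  · push Not at sd
    obtain ⟨f, hf, a, b, c, hne⟩ := sd
    have hc : k (f a b c) ∈ S := by
      refine mem3 (hS.comp _ _ _ _ hf (ng _ hS.p1 a) (ng _ hS.p1 b) (ng _ hS.p1 c)) ?_
      have e : f (1 + a) (1 + b) (1 + c) = f a b c := by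
        rw [add_comm 1 a, add_comm 1 b, add_comm 1 c]
        generalize f (a+1) (b+1) (c+1) = u at *
        generalize f a b c = v at *
        revert u v; decide
      simp [k, e]
    have hk : ∀ d, k d ∈ S := by
      intro d
      have := ng _ hc (f a b c + d)
      refine mem3 this ?_
      simp only [k, and_self]
      generalize f a b c = v
      clear this
      revert v d; decide
    have key : ∀ r00 r01 r10 r11 : B, r00 + r01 + r10 + r11 = 1 → ∃ a b c : B,
        ∀ r : B → B → B, r 0 0 = r00 → r 0 1 = r01 → r 1 0 = r10 → r 1 1 = r11 →
        ∀ x y, r (x + a) (y + b) + c = x * y := by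
      intro r00 r01 r10 r11 h
      have : ∃ a b c : B, (∀ x y : B, (if x + a = 0 then if y + b = 0 then r00 else r01 else
         if y + b = 0 then r10 else r11) + c = x * y) := by
        revert r00 r01 r10 r11; decide
      obtain ⟨a, b, c, h⟩ := this
      refine ⟨a, b, c, fun r h0 h1 h2 h3 x y => ?_⟩
      rw [← h x y]
      rcases two (x + a) with h | h <;> rcases two (y + b) with h' | h' <;> simp [*]
    obtain ⟨a, b, c, hk'⟩ := key _ _ _ _ qq
    have hk2 := hk' (q 0) rfl rfl rfl rfl
    have ha : and2 ∈ S := by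
      have := ng _ (hS.comp _ _ _ _ hq (hk 0) (ng _ hS.p1 a) (ng _ hS.p2 b)) c
      have e : and2 = _ := (funext fun x => funext fun y => funext fun z => (hk2 x y).symm)
      rw [e]; exact this
    have ho : or2 ∈ S :=
      mem3 (ng _ (hS.comp _ _ _ _ ha (ng _ hS.p1 1) (ng _ hS.p2 1) hS.p3) 1) (by decide)
    exact tt_of_and_or hS ha ho hm m1 m2

theorem case_one (hS : Cl S) (h1 : k 1 ∈ S) (pres : ∀ f ∈ S, f 1 1 1 = 1) {h m q : T3}
    (hh : h ∈ S) (e1 : h 1 1 0 = 0) (e2 : h 1 0 1 = 0) (hm : m ∈ S)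
    (m1 : m 0 0 1 = 1) (m2 : m 0 1 1 = 0) (hq : q ∈ S)
    (qq : q 1 1 1 + q 1 1 0 + q 1 0 1 + q 1 0 0 = 1) : tt ∈ S := by
  have orimp : imp2 ∈ S → or2 ∈ S := fun hi =>
    mem3 (hS.comp _ _ _ _ hi hi hS.p2 hS.p2) (by decide)
  have fin : and2 ∈ S → tt ∈ S := by
    intro ha
    have hi : imp2 ∈ S := by
      have p := pres m hm
      refine mem3 (hS.comp _ _ _ _ hm ha hS.p1 h1) ?_
      simp [imp2, and2, k, m1, m2, p]
    exact tt_of_and_or hS ha (orimp hi) hm m1 m2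
  have e3 := pres h hh
  have hr := hS.comp _ _ _ _ hh h1 hS.p1 hS.p2
  rcases two (h 1 0 0) with e4 | e4
  · exact fin (mem3 hr (by simp [and2, k, *]))
  · have hx : (fun x y _ => x + y + 1) ∈ S := mem3 hr (by simp [k, *])
    have hp : mino ∈ S := mem3 (hS.comp _ _ _ _ hx hx hS.p3 hS.p3) (by decide)
    have ora : or2 ∈ S → and2 ∈ S := fun ho =>
      mem3 (hS.comp _ _ _ _ hp hS.p1 hS.p2 ho) (by decide)
    have q1 := pres q hq
    have hr := hS.comp _ _ _ _ hq h1 hS.p1 hS.p2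
    have hr' := hS.comp _ _ _ _ hq h1 hS.p2 hS.p1
    rw [q1] at qq
    rcases two (q 1 1 0) with c1 | c1 <;> rcases two (q 1 0 1) with c2 | c2 <;>
      rcases two (q 1 0 0) with c3 | c3 <;> rw [c1, c2, c3] at qq <;>
      try (exact absurd qq (by decide))
    · exact fin (mem3 hr (by simp [and2, k, *]))
    · exact fin (ora (orimp (mem3 hr (by simp [imp2, k, *]))))
    · exact fin (ora (orimp (mem3 hr' (by simp [imp2, k, *]))))
    · exact fin (ora (mem3 hr (by simp [or2, k, *])))

theorem case_idem (hS : Cl S) (i0 : ∀ f ∈ S, f 0 0 0 = 0) (i1 : ∀ f ∈ S, f 1 1 1 = 1)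
    {g h m q : T3} (hg : g ∈ S) (g1 : g 0 0 1 = 1) (g2 : g 0 1 0 = 1)
    (hh : h ∈ S) (e1 : h 1 1 0 = 0) (e2 : h 1 0 1 = 0) (hm : m ∈ S)
    (m1 : m 0 0 1 = 1) (m2 : m 0 1 1 = 0) (hq : q ∈ S)
    (qq : q 0 0 0 + q 0 0 1 + q 0 1 0 + q 0 1 1 = 1) : tt ∈ S := by
  have A : or2 ∈ S ∨ mino ∈ S ∨ tt ∈ S := by
    have a0 := i0 g hg
    have a1 := i1 g hg
    rcases two (g 1 1 0) with c1 | c1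
    · rcases two (g 1 0 1) with c2 | c2
      · rcases two (g 1 0 0) with c3 | c3
        · rcases two (g 0 1 1) with c4 | c4
          · left
            -- g (y, x, x)-type minors: g 1 0 0 = 0, g 0 1 1 = 0 gives and; combine
            have hand : and2 ∈ S := mem3 (hS.comp _ _ _ _ hg hS.p1 hS.p2 hS.p2)
              (by simp [and2, *])
            exact mem3 (hS.comp _ _ _ _ hg hand hS.p1 hS.p2) (by simp [or2, and2, *])
          · right; right
            exact mem3 (hS.comp _ _ _ _ hg hS.p2 hS.p1 hS.p3) (by simp [tt, *])
        · rcases two (g 0 1 1) with c4 | c4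
          · right; left
            exact mem3 hg (by simp [mino, *])
          · left
            exact mem3 (hS.comp _ _ _ _ hg hS.p1 hS.p2 hS.p2) (by simp [or2, *])
      · left
        exact mem3 (hS.comp _ _ _ _ hg hS.p1 hS.p2 hS.p1) (by simp [or2, *])
    · left
      exact mem3 (hS.comp _ _ _ _ hg hS.p1 hS.p1 hS.p2) (by simp [or2, *])
  have A' : and2 ∈ S ∨ mino ∈ S ∨ tt ∈ S := by
    have a0 := i0 h hh
    have a1 := i1 h hh
    rcases two (h 0 0 1) with c1 | c1
    · left
      exact mem3 (hS.comp _ _ _ _ hh hS.p1 hS.p1 hS.p2) (by simp [and2, *])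
    · rcases two (h 0 1 0) with c2 | c2
      · left
        exact mem3 (hS.comp _ _ _ _ hh hS.p1 hS.p2 hS.p1) (by simp [and2, *])
      · rcases two (h 1 0 0) with c3 | c3
        · rcases two (h 0 1 1) with c4 | c4
          · left
            exact mem3 (hS.comp _ _ _ _ hh hS.p1 hS.p2 hS.p2) (by simp [and2, *])
          · right; right
            exact mem3 (hS.comp _ _ _ _ hh hS.p2 hS.p1 hS.p3) (by simp [tt, *])
        · rcases two (h 0 1 1) with c4 | c4
          · right; left
            exact mem3 hh (by simp [mino, *])
          · left
            have hor : or2 ∈ S := mem3 (hS.comp _ _ _ _ hh hS.p1 hS.p2 hS.p2)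
              (by simp [or2, *])
            exact mem3 (hS.comp _ _ _ _ hh hor hS.p1 hS.p2) (by simp [or2, and2, *])
  by_contra ht
  have notboth : ¬ (and2 ∈ S ∧ or2 ∈ S) := fun hb =>
    ht (tt_of_and_or hS hb.1 hb.2 hm m1 m2)
  have hp : mino ∈ S := by tauto
  have na : and2 ∉ S := fun ha => notboth ⟨ha,
    mem3 (hS.comp _ _ _ _ hp hS.p1 hS.p2 ha) (by decide)⟩
  have no : or2 ∉ S := fun ha => notboth ⟨
    mem3 (hS.comp _ _ _ _ hp hS.p1 hS.p2 ha) (by decide), ha⟩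
  have sd : ∀ f ∈ S, ∀ x y z, f (x+1) (y+1) (z+1) = f x y z + 1 := by
    intro f hf a b c
    by_contra hne
    have sel : ∀ c : B, (fun x y _ => if c = 0 then x else y) ∈ S := by
      intro c
      rcases two c with rfl | rfl
      · simpa using hS.p1
      · simpa using hS.p2
    have hr := hS.comp _ _ _ _ hf (sel a) (sel b) (sel c)
    have a0 := i0 f hf
    have a1 := i1 f hf
    have s1 : ∀ a : B, (if a = 0 then (0 : B) else 1) = a := by decide
    have s2 : ∀ a : B, (if a = 0 then (1 : B) else 0) = a + 1 := by decide
    have e : f (a+1) (b+1) (c+1) = f a b c := by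
      generalize f (a+1) (b+1) (c+1) = u at *
      generalize f a b c = v at *
      revert u v; decide
    rcases two (f a b c) with hv | hv
    · apply na
      refine mem3 hr ?_
      simp only [s1, s2, ite_self, e, hv, a0, a1]
      decide
    · apply no
      refine mem3 hr ?_
      simp only [s1, s2, ite_self, e, hv, a0, a1]
      decide
  rcases sd_lemma hS sd hq (i0 q hq) qq with h | h
  · exact ht (mem3 (hS.comp _ _ _ _ hp h hS.p1 hS.p3) (by decide))
  · exact ht h

def du (f : T3) : T3 := fun x y z => f (x+1) (y+1) (z+1) + 1

theorem du_du (f : T3) : du (du f) = f := by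
  funext x y z; simp [du, add11]

theorem cl_du (hS : Cl S) : Cl {f | du f ∈ S} where
  p1 := by
    have : du (fun x _ _ => x) = fun x _ _ => x := by decide
    simpa [this] using hS.p1
  p2 := by
    have : du (fun _ x _ => x) = fun _ x _ => x := by decide
    simpa [this] using hS.p2
  p3 := by
    have : du (fun _ _ x => x) = fun _ _ x => x := by decide
    simpa [this] using hS.p3
  comp := by
    intro f a b c hf ha hb hc
    have := hS.comp _ _ _ _ hf ha hb hc
    show du _ ∈ S
    simp only [du, add11] at this
    exact this

theorem post (hS : Cl S) {g h m q q' : T3} (hg : g ∈ S) (g1 : g 0 0 1 = 1) (g2 : g 0 1 0 = 1)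
    (hh : h ∈ S) (e1 : h 1 1 0 = 0) (e2 : h 1 0 1 = 0) (hm : m ∈ S)
    (m1 : m 0 0 1 = 1) (m2 : m 0 1 1 = 0) (hq : q ∈ S)
    (qq : q 0 0 0 + q 0 0 1 + q 0 1 0 + q 0 1 1 = 1) (hq' : q' ∈ S)
    (qq' : q' 1 1 1 + q' 1 1 0 + q' 1 0 1 + q' 1 0 0 = 1) : tt ∈ S := by
  by_cases hn : neg1 ∈ S
  · exact case_neg hS hn hm m1 m2 hq qq
  have d0 : k 0 ∉ S → ∀ f ∈ S, f 1 1 1 = 1 := by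
    intro hk f hf
    by_contra hne
    have e : f 1 1 1 = 0 := (two _).resolve_right hne
    have hr := hS.comp _ _ _ _ hf hS.p1 hS.p1 hS.p1
    rcases two (f 0 0 0) with c | c
    · exact hk (mem3 hr (by simp [k, *]))
    · exact hn (mem3 hr (by simp [neg1, *]))
  have d1 : k 1 ∉ S → ∀ f ∈ S, f 0 0 0 = 0 := by
    intro hk f hf
    by_contra hne
    have e : f 0 0 0 = 1 := (two _).resolve_left hne
    have hr := hS.comp _ _ _ _ hf hS.p1 hS.p1 hS.p1
    rcases two (f 1 1 1) with c | c
    · exact hn (mem3 hr (by simp [neg1, *]))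
    · exact hk (mem3 hr (by simp [k, *]))
  by_cases h0 : k 0 ∈ S <;> by_cases h1 : k 1 ∈ S
  · exact absurd (mem3 (hS.comp _ _ _ _ hm h0 hS.p1 h1) (by simp [neg1, k, *])) hn
  · have := case_one (cl_du hS) (h := du g) (m := du (fun x y z => m z y x)) (q := du q)
      (show du (k 1) ∈ S from mem3 h0 (by decide))
      (by
        intro f hf
        have := d1 h1 _ hf
        simp only [du, zero_add] at this
        generalize f 1 1 1 = a at *
        revert a; decide)
      (by simpa [du_du] using hg)
      (by simp [du, g1]) (by simp [du, g2])
      (by simpa [du_du] using hS.comp _ _ _ _ hm hS.p3 hS.p2 hS.p1)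
      (by simp [du, m2]) (by simp [du, m1])
      (by simpa [du_du] using hq)
      (by
        simp only [du, zero_add, show (1 + 1 : B) = 0 from rfl]
        generalize q 0 0 0 = a at *
        generalize q 0 0 1 = b at *
        generalize q 0 1 0 = c at *
        generalize q 0 1 1 = d at *
        revert a b c d; decide)
    exact mem3 (show du tt ∈ S from this) (by decide)
  · exact case_one hS h1 (d0 h0) hh e1 e2 hm m1 m2 hq' qq'
  · exact case_idem hS (d1 h1) (d0 h0) hg g1 g2 hh e1 e2 hm m1 m2 hq qq

/-! Bridge to clones -/

def tern (C : Clone B) : Set T3 := {f | (fun v : Fin 3 → B => f (v 0) (v 1) (v 2)) ∈ C.ops 2}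

theorem cl_tern (C : Clone B) : Cl (tern C) where
  p1 := C.proj_mem 2 0
  p2 := C.proj_mem 2 1
  p3 := C.proj_mem 2 2
  comp := by
    intro f a b c hf ha hb hc
    have := C.comp_mem _ ![_, _, _] hf (by
      intro i
      fin_cases i
      · exact ha
      · exact hb
      · exact hc)
    exact this

theorem tern_minor (C : Clone B) {n : ℕ} {f : Op B n} (hf : f ∈ C.ops n) (s : Fin (n+1) → Fin 3) :
    (fun x y z => f (fun i => ![x, y, z] (s i))) ∈ tern C := by
  have := C.comp_mem f (fun i => fun v : Fin 3 → B => v (s i)) hf (fun i => C.proj_mem 2 (s i))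
  have e : (fun v : Fin 3 → B => f (fun i => v (s i))) =
      fun v => f (fun i => ![v 0, v 1, v 2] (s i)) := by
    funext v
    congr 1
    funext i
    generalize s i = j
    fin_cases j <;> rfl
  rw [e] at this
  exact this

/-! Infinitude -/

theorem cequiv_equivalence (C : Clone B) : Equivalence (CEquiv C) := by
  have tr : ∀ {f g h : Ops B}, Minor C f g → Minor C g h → Minor C f h := by
    rintro f g h ⟨a, ha, ea⟩ ⟨b, hb, eb⟩
    refine ⟨fun i x => b i (fun j => a j x), fun i => C.comp_mem _ _ (hb i) ha, ?_⟩
    rw [ea, eb]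
  have rf : ∀ f : Ops B, Minor C f f := fun f => ⟨fun i x => x i, fun i => C.proj_mem _ i, rfl⟩
  exact ⟨fun f => ⟨rf f, rf f⟩, fun h => ⟨h.2, h.1⟩,
    fun h h' => ⟨tr h.1 h'.1, tr h'.2 h.2⟩⟩

theorem infinite_of_family (C : Clone B) (F : ∀ n, Op B n)
    (hF : ∀ m n, n < m → ¬ Minor C ⟨m, F m⟩ ⟨n, F n⟩) : Infinite (Quot (CEquiv C)) := by
  refine Infinite.of_injective (fun n : ℕ => Quot.mk (CEquiv C) ⟨n, F n⟩) ?_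
  intro m n h
  have h' : CEquiv C ⟨m, F m⟩ ⟨n, F n⟩ := by
    have := Quot.eqvGen_exact h
    exact (cequiv_equivalence C).eqvGen_iff.1 this
  rcases lt_trichotomy m n with hl | hl | hl
  · exact absurd h'.2 (hF _ _ hl)
  · exact hl
  · exact absurd h'.1 (hF _ _ hl)

def dop {n : ℕ} (f : Op B n) : Op B n := fun x => f (fun i => x i + 1) + 1

theorem dop_dop {n : ℕ} (f : Op B n) : dop (dop f) = f := by
  funext x; simp [dop, add11]

def dC (C : Clone B) : Clone B where
  ops n := {f | dop f ∈ C.ops n}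
  proj_mem n i := by
    have : dop (fun x : Fin (n+1) → B => x i) = fun x => x i := by
      funext x; simp [dop, add11]
    simpa [this] using C.proj_mem n i
  comp_mem := by
    intro m n g h hg hh
    have := C.comp_mem _ (fun i => dop (h i)) hg hh
    show dop _ ∈ C.ops n
    simp only [dop, add11] at this
    exact this

theorem minor_dual (C : Clone B) {f g : Ops B} (h : Minor (dC C) f g) :
    Minor C ⟨f.1, dop f.2⟩ ⟨g.1, dop g.2⟩ := by
  obtain ⟨a, ha, e⟩ := h
  refine ⟨fun i => dop (a i), ha, ?_⟩
  simp only [e]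
  funext x
  simp [dop, add11]

theorem infinite_of_dual (C : Clone B) (F : ∀ n, Op B n)
    (hF : ∀ m n, n < m → ¬ Minor (dC C) ⟨m, F m⟩ ⟨n, F n⟩) : Infinite (Quot (CEquiv C)) := by
  refine infinite_of_family C (fun n => dop (F n)) (fun m n hl h => hF m n hl ?_)
  obtain ⟨a, ha, e⟩ := h
  refine ⟨fun i => dop (a i), fun i => ?_, ?_⟩
  · show dop (dop (a i)) ∈ C.ops m
    rw [dop_dop]; exact ha i
  · have e' := congrArg dop e
    simp only [dop_dop] at e'
    rw [e']
    funext x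
    simp [dop, add11]

/-- case L -/
theorem affine_family (C : Clone B)
    (hC : ∀ n, ∀ f ∈ C.ops n, ∀ a b : Fin (n+1) → B,
      f (fun i => 1 + a i + b i) = f (fun _ => 1) + f a + f b) :
    ∀ m n, n < m → ¬ Minor C ⟨m, fun x => if x = fun _ => 1 then 1 else 0⟩
      ⟨n, fun x => if x = fun _ => 1 then 1 else 0⟩ := by
  rintro m n hl ⟨h, hh, e⟩
  obtain ⟨a, b, hab, hE⟩ := Fintype.exists_ne_map_eq_of_card_lt
    (fun (x : Fin (m+1) → B) => fun i : Fin (n+1) => h i x)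
    (by simpa using Nat.pow_lt_pow_right (by norm_num : 1 < 2) (Nat.succ_lt_succ hl))
  have hv : (fun i => h i (fun j => 1 + a j + b j)) = fun i => h i (fun _ => 1) := by
    funext i
    rw [hC _ _ (hh i), show h i a = h i b from congrFun hE i]
    generalize h i b = u
    generalize h i _ = v
    revert u v; decide
  have e1 := congrFun e (fun j => 1 + a j + b j)
  have e2 := congrFun e (fun _ => 1)
  simp only at e1 e2
  rw [hv, ← e2, if_pos trivial] at e1
  split_ifs at e1 with hc
  · apply hab
    funext j
    have := congrFun hc j
    generalize a j = u at *
    generalize b j = v at *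
    revert u v; decide
  · exact absurd e1 (by decide)

theorem not_q' (C : Clone B) (hn : ¬ ∃ q' ∈ tern C,
    q' 1 1 1 + q' 1 1 0 + q' 1 0 1 + q' 1 0 0 = 1) :
    ∀ m n, n < m → ¬ Minor C ⟨m, fun x => if x = fun _ => 1 then 1 else 0⟩
      ⟨n, fun x => if x = fun _ => 1 then 1 else 0⟩ := by
  apply affine_family
  intro n f hf
  have key : ∀ a b : Fin (n+1) → B, (∀ i, a i = 1 ∨ b i = 1) →
      f (fun i => 1 + a i + b i) = f (fun _ => 1) + f a + f b := by
    intro a b hab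
    by_contra hne
    apply hn
    refine ⟨_, tern_minor C hf
      (fun i => if a i = 1 then (if b i = 1 then 0 else 1) else 2), ?_⟩
    have e : ∀ (x y z : B) (c : Fin (n+1) → B), (∀ i, ![x, y, z]
        (if a i = 1 then (if b i = 1 then 0 else 1) else 2) = c i) →
        f (fun i => ![x, y, z] (if a i = 1 then (if b i = 1 then 0 else 1) else 2)) = f c := by
      intro x y z c h; congr 1; funext i; exact h i
    have ee : ∀ (u v : B), (u = 1 ∨ v = 1) →
      (![1, 1, 1] (if u = 1 then (if v = 1 then 0 else 1) else 2 : Fin 3) = (1 : B)) ∧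
      (![1, 1, 0] (if u = 1 then (if v = 1 then 0 else 1) else 2 : Fin 3) = u) ∧
      (![1, 0, 1] (if u = 1 then (if v = 1 then 0 else 1) else 2 : Fin 3) = v) ∧
      (![1, 0, 0] (if u = 1 then (if v = 1 then 0 else 1) else 2 : Fin 3) = 1 + u + v) := by
      decide
    rw [e 1 1 1 (fun _ => 1) (fun i => (ee _ _ (hab i)).1),
      e 1 1 0 a (fun i => (ee _ _ (hab i)).2.1),
      e 1 0 1 b (fun i => (ee _ _ (hab i)).2.2.1),
      e 1 0 0 (fun i => 1 + a i + b i) (fun i => (ee _ _ (hab i)).2.2.2)]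
    generalize f (fun i => 1 + a i + b i) = u at *
    generalize f (fun _ => 1) = v at *
    generalize f a = w at *
    generalize f b = z at *
    revert u v w z; decide
  intro a b
  have k1 := key (fun i => 1 + b i + a i * b i) (fun i => 1 + a i + a i * b i) (by
    intro i
    generalize a i = u
    generalize b i = v
    revert u v; decide)
  have k2 := key (fun i => 1 + b i + a i * b i) (fun i => a i + b i + a i * b i) (by
    intro i
    generalize a i = u
    generalize b i = v
    revert u v; decide)
  have k3 := key (fun i => 1 + a i + a i * b i) (fun i => a i + b i + a i * b i) (by
    intro i
    generalize a i = u
    generalize b i = v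
    revert u v; decide)
  have i1 : ∀ u v : B, 1 + (1 + v + u * v) + (1 + u + u * v) = 1 + u + v ∧
     1 + (1 + v + u * v) + (u + v + u * v) = u ∧ 1 + (1 + u + u * v) + (u + v + u * v) = v := by
    decide
  simp only [fun i => (i1 (a i) (b i)).1] at k1
  simp only [fun i => (i1 (a i) (b i)).2.1] at k2
  simp only [fun i => (i1 (a i) (b i)).2.2] at k3
  rw [k1, k2, k3]
  have fin : ∀ o p q r : B, o + p + q = o + (o + p + r) + (o + q + r) := by decide
  exact fin _ _ _ _

def par (n : ℕ) : Op B n := fun x => ∑ i, x i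

theorem not_m (C : Clone B) (hn : ¬ ∃ m ∈ tern C, m 0 0 1 = 1 ∧ m 0 1 1 = 0) :
    ∀ m n, n < m → ¬ Minor C ⟨m, par m⟩ ⟨n, par n⟩ := by
  have mono : ∀ n, ∀ f ∈ C.ops n, ∀ a b : Fin (n+1) → B, a ≤ b → f a ≤ f b := by
    intro n f hf a b hab
    by_contra hne
    apply hn
    refine ⟨_, tern_minor C hf
      (fun i => if a i = 1 then 2 else (if b i = 1 then 1 else 0)), ?_⟩
    have ee : ∀ (u v : B), u ≤ v →
      (![0, 0, 1] (if u = 1 then 2 else (if v = 1 then 1 else 0) : Fin 3) = u) ∧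
      (![0, 1, 1] (if u = 1 then 2 else (if v = 1 then 1 else 0) : Fin 3) = v) := by
      decide
    simp only [fun i => (ee _ _ (hab i)).1, fun i => (ee _ _ (hab i)).2]
    generalize f a = u at *
    generalize f b = v at *
    revert u v; decide
  rintro m n hl ⟨h, hh, e⟩
  simp only at e hh h
  -- chain
  let c : ℕ → Fin (m+1) → B := fun j i => if i.val < j then 1 else 0
  have hc : ∀ j, c j ≤ c (j+1) := by
    intro j i
    simp only [c]
    split_ifs <;> first | omega | simp
  have hpar : ∀ j, j < m + 1 → par m (c (j+1)) = par m (c j) + 1 := by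
    intro j hj
    have : ∀ i, c (j+1) i = c j i + if i = ⟨j, hj⟩ then 1 else 0 := by
      intro i
      simp only [c, Fin.ext_iff]
      split_ifs <;> first | omega | simp
    simp only [par, this, Finset.sum_add_distrib]
    simp
  let w : ℕ → Finset (Fin (n+1)) := fun j => Finset.univ.filter (fun i => h i (c j) = 1)
  have hw : ∀ j, j ≤ m + 1 → j ≤ (w j).card := by
    intro j
    induction j with
    | zero => intro _; exact Nat.zero_le _
    | succ j ih =>
      intro hj
      have := ih (by omega)
      have hlt : w j ⊂ w (j+1) := by
        rw [Finset.ssubset_iff_subset_ne]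
        constructor
        · intro i hi
          simp only [w, Finset.mem_filter, Finset.mem_univ, true_and] at hi ⊢
          have := mono _ _ (hh i) _ _ (hc j)
          rw [hi] at this
          have up : ∀ u : B, 1 ≤ u → u = 1 := by decide
          exact up _ this
        · intro heq
          have hp := hpar j (by omega)
          rw [e] at hp
          have : (fun i => h i (c (j+1))) = fun i => h i (c j) := by
            funext i
            have := Finset.ext_iff.1 heq i
            simp only [w, Finset.mem_filter, Finset.mem_univ, true_and] at this
            generalize h i _ = u at *
            generalize h i _ = v at *
            revert u v; decide
          simp only [this] at hp
          generalize par n _ = u at *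
          revert u; decide
      have := Finset.card_lt_card hlt
      omega
  have h1 := hw (m+1) le_rfl
  have h2 := Finset.card_le_univ (w (m+1))
  simp at h2
  omega

theorem not_g (C : Clone B) (hn : ¬ ∃ g ∈ tern C, g 0 0 1 = 1 ∧ g 0 1 0 = 1) :
    ∀ m n, n < m → ¬ Minor C ⟨m, par m⟩ ⟨n, par n⟩ := by
  have disj : ∀ n, ∀ f ∈ C.ops n, ∀ a b : Fin (n+1) → B, (∀ i, a i = 0 ∨ b i = 0) →
      ¬ (f a = 1 ∧ f b = 1) := by
    intro n f hf a b hab hne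
    apply hn
    refine ⟨_, tern_minor C hf
      (fun i => if a i = 1 then 2 else (if b i = 1 then 1 else 0)), ?_⟩
    have ee : ∀ (u v : B), (u = 0 ∨ v = 0) →
      (![0, 0, 1] (if u = 1 then 2 else (if v = 1 then 1 else 0) : Fin 3) = u) ∧
      (![0, 1, 0] (if u = 1 then 2 else (if v = 1 then 1 else 0) : Fin 3) = v) := by
      decide
    simp only [fun i => (ee _ _ (hab i)).1, fun i => (ee _ _ (hab i)).2]
    exact hne
  rintro m n hl ⟨h, hh, e⟩
  simp only at e hh h
  have ex : ∀ j : Fin (m+1), ∃ i, h i (Pi.single j 1) = 1 := by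
    intro j
    by_contra hne
    push Not at hne
    have h0 : ∀ i, h i (Pi.single j 1) = 0 := fun i => (two _).resolve_right (hne i)
    have := congrFun e (Pi.single j 1)
    simp [par, h0] at this
  choose s hs using ex
  have inj : Function.Injective s := by
    intro j j' hjj
    by_contra hne
    refine disj _ _ (hh (s j)) (Pi.single j 1) (Pi.single j' 1) ?_ ⟨hs j, hjj ▸ hs j'⟩
    intro i
    by_cases hi : i = j
    · right
      subst hi
      simp [hne]
    · left
      simp [hi]
  have := Fintype.card_le_of_injective s inj
  simp at this
  omega

theorem tern_dual (C : Clone B) (f : T3) : f ∈ tern (dC C) ↔ du f ∈ tern C := Iff.rfl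

end PostAux

open PostAux in
theorem non_discriminator_clone_infinitely_many_classes (C : Clone (Fin 2))
    (hC : discOp (Fin 2) ∉ C.ops 2) :
    Infinite (Quot (CEquiv C)) := by
  by_cases hm : ∃ m ∈ tern C, m 0 0 1 = 1 ∧ m 0 1 1 = 0
  swap
  · exact infinite_of_family C _ (not_m C hm)
  by_cases hg : ∃ g ∈ tern C, g 0 0 1 = 1 ∧ g 0 1 0 = 1
  swap
  · exact infinite_of_family C _ (not_g C hg)
  by_cases hq' : ∃ q' ∈ tern C, q' 1 1 1 + q' 1 1 0 + q' 1 0 1 + q' 1 0 0 = 1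
  swap
  · exact infinite_of_family C (fun n x => if x = fun _ => 1 then 1 else 0) (not_q' C hq')
  by_cases hg2 : ∃ g ∈ tern (dC C), g 0 0 1 = 1 ∧ g 0 1 0 = 1
  swap
  · exact infinite_of_dual C _ (not_g _ hg2)
  by_cases hq2 : ∃ q' ∈ tern (dC C), q' 1 1 1 + q' 1 1 0 + q' 1 0 1 + q' 1 0 0 = 1
  swap
  · exact infinite_of_dual C (fun n x => if x = fun _ => 1 then 1 else 0) (not_q' _ hq2)
  exfalso
  obtain ⟨m, hm, m1, m2⟩ := hm
  obtain ⟨g, hg, g1, g2⟩ := hg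
  obtain ⟨q', hq', qq'⟩ := hq'
  obtain ⟨h, hh, e1, e2⟩ := hg2
  obtain ⟨q, hq, qq⟩ := hq2
  rw [tern_dual] at hh hq
  have : tt ∈ tern C := by
    refine post (cl_tern C) hg g1 g2 hh ?_ ?_ hm m1 m2 hq ?_ hq' qq'
    · simp [du, e1]
    · simp [du, e2]
    · simp only [du, zero_add, show (1 + 1 : B) = 0 from rfl]
      generalize q 1 1 1 = a at *
      generalize q 1 1 0 = b at *
      generalize q 1 0 1 = c at *
      generalize q 1 0 0 = d at *
      revert a b c d; decide
  exact hC this
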